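/- arXiv:1003.1566 — 3 statements merged into one kernel-verified Lean document; each statement's English description precedes it below -/
import Mathlib

section
/- Let λ ∈ (−π/2, π/2) and f ∈ F_λ, and let β(t) = lim_{r→1−} u_f(r e^{it}) + t (which exists for all t, is non-decreasing, and satisfies β(t + 2π) = β(t) + 2π). Then f is represented by f(z) = z·exp( −(e^{iλ} cos λ / π) ∫_{[0,2π)} Log(1 − e^{−it} z) dμ_β(t) ) for all z ∈ 𝔻, where μ_β is the Lebesgue–Stieltjes measure associated with β and Log is the principal logarithm. -/
open Set Metric Filter Topology MeasureTheory

/-- The class `F_λ` of (normalized) `λ`-spirallike functions on the unit disk. -/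
def SpiralClass (lam : ℝ) : Set (ℂ → ℂ) :=
  {f | DifferentiableOn ℂ f (ball (0 : ℂ) 1) ∧ f 0 = 0 ∧ deriv f 0 = 1 ∧
    (∀ z ∈ ball (0 : ℂ) 1, z ≠ 0 → f z ≠ 0) ∧
    ∀ z ∈ ball (0 : ℂ) 1, z ≠ 0 →
      0 < (Complex.exp (-(lam : ℂ) * Complex.I) * z * deriv f z / f z).re}

/-- `L` is the (unique) analytic branch of `log (f z / z)` on the disk vanishing at `0`. -/
def IsLogBranch (f L : ℂ → ℂ) : Prop :=
  DifferentiableOn ℂ L (ball (0 : ℂ) 1) ∧ L 0 = 0 ∧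
    ∀ z ∈ ball (0 : ℂ) 1, z ≠ 0 → Complex.exp (L z) = f z / z

/-- The canonical harmonic branch `u_f = Im L_f − (tan λ)·Re L_f` of the
`λ`-argument of `f(z)/z`. -/
noncomputable def lambdaArgBranch (lam : ℝ) (L : ℂ → ℂ) (z : ℂ) : ℝ :=
  (L z).im - Real.tan lam * (L z).re

lemma aux_mean (h : ℂ → ℂ) (ρ : ℝ) (hρ : 1 < ρ) (hh : DifferentiableOn ℂ h (ball 0 ρ)) :
    ∫ t in (0:ℝ)..(2 * Real.pi), h (Complex.exp (t * Complex.I)) = 2 * Real.pi * h 0 := by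
  have hd : DiffContOnCl ℂ h (ball 0 |(1:ℝ)|) := by
    apply DifferentiableOn.diffContOnCl
    rw [abs_one, closure_ball _ one_ne_zero]
    exact hh.mono (closedBall_subset_ball hρ)
  have := hd.circleAverage
  rw [Real.circleAverage_def] at this
  simp only [circleMap, Complex.ofReal_one, one_mul, zero_add] at this
  have hp : (Real.pi : ℂ) ≠ 0 := by exact_mod_cast Real.pi_ne_zero
  rw [← this, Complex.real_smul, ← mul_assoc]
  push_cast
  rw [mul_inv_cancel₀ (by simpa using hp), one_mul]

lemma aux_exp_norm (t : ℝ) : ‖Complex.exp (t * Complex.I)‖ = 1 := Complex.norm_exp_ofReal_mul_I t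

lemma aux_ne (t : ℝ) (z : ℂ) (hz : ‖z‖ < 1) : Complex.exp (t * Complex.I) - z ≠ 0 := by
  intro h
  have := aux_exp_norm t
  rw [sub_eq_zero.1 h] at this
  linarith

lemma aux_cont (h : ℂ → ℂ) (ρ : ℝ) (hρ : 1 < ρ) (hh : DifferentiableOn ℂ h (ball 0 ρ)) :
    Continuous fun t : ℝ => h (Complex.exp (t * Complex.I)) := by
  apply hh.continuousOn.comp_continuous (by fun_prop)
  intro t
  simp [hρ]

lemma aux_kernel_cont (z : ℂ) (hz : ‖z‖ < 1) :
    Continuous fun t : ℝ => z / (Complex.exp (t * Complex.I) - z) := by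
  apply Continuous.div (by fun_prop) (by fun_prop)
  exact fun t => aux_ne t z hz

lemma aux_cauchy (h : ℂ → ℂ) (ρ : ℝ) (hρ : 1 < ρ) (hh : DifferentiableOn ℂ h (ball 0 ρ))
    (z : ℂ) (hz : ‖z‖ < 1) :
    ∫ t in (0:ℝ)..(2 * Real.pi), h (Complex.exp (t * Complex.I)) *
      (z / (Complex.exp (t * Complex.I) - z)) = 2 * Real.pi * (h z - h 0) := by
  have hd : DiffContOnCl ℂ h (ball 0 |(1:ℝ)|) := by
    apply DifferentiableOn.diffContOnCl
    rw [abs_one, closure_ball _ one_ne_zero]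
    exact hh.mono (closedBall_subset_ball hρ)
  have := hd.circleAverage_smul_div (w := z) (by simpa using hz)
  rw [Real.circleAverage_def] at this
  simp only [circleMap, Complex.ofReal_one, one_mul, zero_add, sub_zero, smul_eq_mul] at this
  have h2 := aux_mean h ρ hρ hh
  have hc := aux_cont h ρ hρ hh
  have e : ∀ t : ℝ, h (Complex.exp (t * Complex.I)) * (z / (Complex.exp (t * Complex.I) - z))
     = Complex.exp (t * Complex.I) / (Complex.exp (t * Complex.I) - z) * h (Complex.exp (t * Complex.I))
       - h (Complex.exp (t * Complex.I)) := by
    intro t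
    have := aux_ne t z hz
    field_simp
    ring
  simp_rw [e]
  have hp : (Real.pi : ℂ) ≠ 0 := by exact_mod_cast Real.pi_ne_zero
  rw [intervalIntegral.integral_sub, h2, ← this, Complex.real_smul, mul_sub, ← mul_assoc]
  · push_cast
    rw [mul_inv_cancel₀ (by simpa using hp), one_mul]
  · apply Continuous.intervalIntegrable
    apply Continuous.mul _ hc
    exact Continuous.div (by fun_prop) (by fun_prop) (fun t => aux_ne t z hz)
  · exact hc.intervalIntegrable _ _

lemma aux_one_sub_ne (w z : ℂ) (hz : ‖z‖ * ‖w‖ < 1) : 1 - z * w ≠ 0 := by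
  intro h
  have : ‖z * w‖ = 1 := by rw [← sub_eq_zero.1 h]; simp
  rw [norm_mul] at this
  linarith

lemma aux_rho (z : ℂ) (hz : ‖z‖ < 1) : ∃ ρ : ℝ, 1 < ρ ∧ ∀ w ∈ ball (0:ℂ) ρ, ‖z‖ * ‖w‖ < 1 := by
  have h0 : 0 < 1 + ‖z‖ := by positivity
  refine ⟨2 / (1 + ‖z‖), by rw [lt_div_iff₀ h0]; linarith, fun w hw => ?_⟩
  simp only [mem_ball, dist_zero_right] at hw
  rw [lt_div_iff₀ h0] at hw
  nlinarith [norm_nonneg z, norm_nonneg w]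

lemma aux_anti (h : ℂ → ℂ) (ρ : ℝ) (hρ : 1 < ρ) (hh : DifferentiableOn ℂ h (ball 0 ρ))
    (z : ℂ) (hz : ‖z‖ < 1) :
    ∫ t in (0:ℝ)..(2 * Real.pi), (starRingEnd ℂ) (h (Complex.exp (t * Complex.I))) *
      (z / (Complex.exp (t * Complex.I) - z)) = 0 := by
  obtain ⟨ρ', h1, hρ'⟩ := aux_rho ((starRingEnd ℂ) z) (by simpa using hz)
  have := aux_mean (fun w => h w * ((starRingEnd ℂ) z * w / (1 - (starRingEnd ℂ) z * w))) (min ρ ρ')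
    (lt_min hρ h1) (by
      apply DifferentiableOn.mul (hh.mono (ball_subset_ball (min_le_left _ _)))
      apply DifferentiableOn.div (by fun_prop) (by fun_prop)
      intro w hw
      exact aux_one_sub_ne _ _ (hρ' _ (ball_subset_ball (min_le_right _ _) hw)))
  simp only [mul_zero, zero_div] at this
  have h2 := congrArg (starRingEnd ℂ) this
  rw [map_zero, ← intervalIntegral.intervalIntegral_conj] at h2
  rw [← h2]
  congr 1
  ext t
  simp only [map_mul, map_div₀, map_sub, Complex.conj_conj, map_one, ← Complex.exp_conj, Complex.conj_I, Complex.conj_ofReal, mul_neg, Complex.exp_neg]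
  congr 1
  have := aux_ne t z hz
  have := Complex.exp_ne_zero (t * Complex.I)
  field_simp

lemma aux_schwarz (h : ℂ → ℂ) (ρ : ℝ) (hρ : 1 < ρ) (hh : DifferentiableOn ℂ h (ball 0 ρ))
    (z : ℂ) (hz : ‖z‖ < 1) :
    ∫ t in (0:ℝ)..(2 * Real.pi), ((h (Complex.exp (t * Complex.I))).im : ℂ) *
      (z / (Complex.exp (t * Complex.I) - z)) = - Complex.I * Real.pi * (h z - h 0) := by
  have hc := aux_cont h ρ hρ hh
  have hk := aux_kernel_cont z hz
  have e : ∀ t : ℝ, ((h (Complex.exp (t * Complex.I))).im : ℂ) * (z / (Complex.exp (t * Complex.I) - z))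
     = (-Complex.I / 2) * (h (Complex.exp (t * Complex.I)) * (z / (Complex.exp (t * Complex.I) - z))
       - (starRingEnd ℂ) (h (Complex.exp (t * Complex.I))) * (z / (Complex.exp (t * Complex.I) - z))) := by
    intro t
    have : ∀ w : ℂ, (w.im : ℂ) = (-Complex.I / 2) * (w - (starRingEnd ℂ) w) := by
      intro w
      rw [Complex.sub_conj]
      push_cast
      linear_combination (w.im : ℂ) * Complex.I_mul_I
    rw [this]
    ring
  simp_rw [e]
  rw [intervalIntegral.integral_const_mul, intervalIntegral.integral_sub, aux_cauchy h ρ hρ hh z hz,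
    aux_anti h ρ hρ hh z hz]
  · ring
  · exact (hc.mul hk).intervalIntegrable _ _
  · exact ((Complex.continuous_conj.comp hc).mul hk).intervalIntegrable _ _

lemma aux_log_mean (z : ℂ) (hz : ‖z‖ < 1) :
    ∫ t in (0:ℝ)..(2 * Real.pi), Complex.log (1 - Complex.exp (-(t:ℂ) * Complex.I) * z) = 0 := by
  obtain ⟨ρ, h1, hρ⟩ := aux_rho z hz
  have hd : DiffContOnCl ℂ (fun w => Complex.log (1 - w * z)) (ball 0 |(1:ℝ)|) := by
    apply DifferentiableOn.diffContOnCl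
    rw [abs_one, closure_ball _ one_ne_zero]
    refine DifferentiableOn.mono ?_ (closedBall_subset_ball h1)
    intro w hw
    apply DifferentiableAt.differentiableWithinAt
    apply DifferentiableAt.clog (by fun_prop)
    rw [sub_eq_add_neg]
    apply Complex.mem_slitPlane_of_norm_lt_one (z := -(w * z))
    rw [norm_neg, norm_mul, mul_comm]; exact hρ w hw
  have := hd.circleAverage
  rw [← Real.circleAverage_zero_one_congr_inv, Real.circleAverage_def] at this
  simp only [circleMap, Complex.ofReal_one, one_mul, zero_add, zero_mul, sub_zero, Complex.log_one, smul_eq_zero, ← Complex.exp_neg] at this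
  rcases this with h | h
  · exfalso; have := Real.pi_pos; simp at h
  · simpa [neg_mul] using h

lemma aux_ibp (g : StieltjesFunction ℝ) (φ φ' : ℝ → ℂ) (hφ : ∀ t, HasDerivAt φ (φ' t) t)
    (hφ' : Continuous φ') (a b : ℝ) (hab : a ≤ b) :
    ∫ t in Ico a b, φ t ∂g.measure = φ b * ((Function.leftLim g b - Function.leftLim g a : ℝ) : ℂ)
      - ∫ s in a..b, φ' s * ((Function.leftLim g s - Function.leftLim g a : ℝ) : ℂ) := by
  have hfin : IsFiniteMeasure (g.measure.restrict (Ico a b)) :=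
    ⟨by rw [Measure.restrict_apply_univ, g.measure_Ico]; exact ENNReal.ofReal_lt_top⟩
  have hm : ∀ s, a ≤ s → g.measure.real (Ico a s) = Function.leftLim g s - Function.leftLim g a := by
    intro s hs
    rw [Measure.real, g.measure_Ico, ENNReal.toReal_ofReal]
    exact sub_nonneg.2 (g.mono.leftLim hs)
  have h1 : ∀ t ∈ Ico a b, φ t = φ b - ∫ s in Ioc a b, (Ioi t).indicator φ' s := by
    intro t ht
    have h2 := intervalIntegral.integral_eq_sub_of_hasDerivAt (a := t) (b := b) (fun x _ => hφ x)
      (hφ'.intervalIntegrable _ _)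
    rw [intervalIntegral.integral_of_le ht.2.le] at h2
    rw [setIntegral_indicator measurableSet_Ioi]
    have : Ioc a b ∩ Ioi t = Ioc t b := by
      ext x; simp only [mem_inter_iff, mem_Ioc, mem_Ioi]
      constructor
      · rintro ⟨⟨_, h⟩, h'⟩; exact ⟨h', h⟩
      · rintro ⟨h', h⟩; exact ⟨⟨ht.1.trans_lt h', h⟩, h'⟩
    rw [this, h2]; ring
  have hbd : Integrable (Function.uncurry fun t s => (Ioi t).indicator φ' s)
      ((g.measure.restrict (Ico a b)).prod (volume.restrict (Ioc a b))) := by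
    have h3 : Integrable (fun p : ℝ × ℝ => φ' p.2)
        ((g.measure.restrict (Ico a b)).prod (volume.restrict (Ioc a b))) := by
      apply Integrable.comp_snd
      have := (hφ'.intervalIntegrable (μ := volume) a b)
      rwa [intervalIntegrable_iff_integrableOn_Ioc_of_le hab] at this
    have : (Function.uncurry fun t s => (Ioi t).indicator φ' s)
       = {p : ℝ × ℝ | p.1 < p.2}.indicator (fun p => φ' p.2) := by
      ext ⟨t, s⟩
      simp [indicator_apply]
    rw [this]
    exact h3.indicator (measurableSet_lt measurable_fst measurable_snd)
  have hbd2 : Integrable (fun t => ∫ s in Ioc a b, (Ioi t).indicator φ' s)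
      (g.measure.restrict (Ico a b)) := hbd.integral_prod_left
  rw [setIntegral_congr_fun measurableSet_Ico h1, integral_sub (integrable_const _) hbd2,
    integral_integral_swap hbd, setIntegral_const, hm b hab, intervalIntegral.integral_of_le hab]
  congr 1
  · rw [Complex.real_smul, mul_comm]
  · apply setIntegral_congr_fun measurableSet_Ioc
    intro s hs
    have : ∀ t, (Ioi t).indicator φ' s = (Iio s).indicator (fun _ => φ' s) t := by
      intro t; simp [indicator_apply]
    simp_rw [this]
    rw [setIntegral_indicator measurableSet_Iio]
    have : Ico a b ∩ Iio s = Ico a s := by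
      ext x; simp only [mem_inter_iff, mem_Ico, mem_Iio]
      constructor
      · rintro ⟨⟨h, _⟩, h'⟩; exact ⟨h, h'⟩
      · rintro ⟨h, h'⟩; exact ⟨⟨h, h'.trans_le hs.2⟩, h'⟩
    rw [this, setIntegral_const, hm s hs.1.le, Complex.real_smul, mul_comm]

lemma aux_phi_deriv (z : ℂ) (hz : ‖z‖ < 1) (t : ℝ) :
    HasDerivAt (fun t : ℝ => Complex.log (1 - Complex.exp (-(t:ℂ) * Complex.I) * z))
      (Complex.I * (z / (Complex.exp (t * Complex.I) - z))) t := by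
  have h1 : HasDerivAt (fun t : ℝ => 1 - Complex.exp (-(t:ℂ) * Complex.I) * z)
      (Complex.I * Complex.exp (-(t:ℂ) * Complex.I) * z) t := by
    have h0 : HasDerivAt (fun t : ℝ => -(t:ℂ) * Complex.I) (-1 * Complex.I) t :=
      ((Complex.ofRealCLM.hasDerivAt (x := t)).neg).mul_const _
    have := ((h0.cexp).mul_const z).const_sub 1
    exact this.congr_deriv (by ring)
  have h2 : 1 - Complex.exp (-(t:ℂ) * Complex.I) * z ∈ Complex.slitPlane := by
    rw [sub_eq_add_neg]
    apply Complex.mem_slitPlane_of_norm_lt_one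
    rw [norm_neg, norm_mul]
    have := aux_exp_norm (-t)
    push_cast at this
    rw [this, one_mul]; exact hz
  convert h1.clog_real h2 using 1
  have h3 := aux_ne t z hz
  have h4 := Complex.slitPlane_ne_zero h2
  have h5 := Complex.exp_ne_zero (t * Complex.I)
  rw [neg_mul, Complex.exp_neg] at *
  have : 1 - (Complex.exp (t * Complex.I))⁻¹ * z = (Complex.exp (t * Complex.I) - z) / Complex.exp (t * Complex.I) := by
    field_simp
  rw [this]
  field_simp

lemma aux_stieltjes (β : ℝ → ℝ) (hmono : Monotone β)
    (hper : ∀ t : ℝ, β (t + 2 * Real.pi) = β t + 2 * Real.pi) (z : ℂ) (hz : ‖z‖ < 1) :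
    ∫ t in Set.Ico (0 : ℝ) (2 * Real.pi),
            Complex.log (1 - Complex.exp (-(t : ℂ) * Complex.I) * z)
              ∂hmono.stieltjesFunction.measure =
    - Complex.I * ∫ t in (0:ℝ)..(2 * Real.pi), ((β t - t : ℝ) : ℂ) *
      (z / (Complex.exp (t * Complex.I) - z)) := by
  have hk := aux_kernel_cont z hz
  have hk' : Continuous fun t : ℝ => Complex.I * (z / (Complex.exp (t * Complex.I) - z)) :=
    continuous_const.mul hk
  have hl : ∀ x, Function.leftLim hmono.stieltjesFunction x = Function.leftLim β x := by
    intro x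
    change Function.leftLim (Function.rightLim β) x = _
    exact leftLim_rightLim (hmono.tendsto_leftLim x)
  have hl2 : Function.leftLim β (2 * Real.pi) = Function.leftLim β 0 + 2 * Real.pi := by
    apply leftLim_eq_of_tendsto
    have h1 : Tendsto (fun x : ℝ => x - 2 * Real.pi) (𝓝[<] (2 * Real.pi)) (𝓝[<] 0) := by
      apply tendsto_nhdsWithin_of_tendsto_nhds_of_eventually_within
      · apply tendsto_nhdsWithin_of_tendsto_nhds
        have : Continuous fun x : ℝ => x - 2 * Real.pi := by fun_prop
        simpa using this.tendsto (2 * Real.pi)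
      · filter_upwards [self_mem_nhdsWithin] with x hx
        simp only [mem_Iio] at *
        linarith
    have h2 := ((hmono.tendsto_leftLim 0).comp h1).add_const (2 * Real.pi)
    refine h2.congr fun x => ?_
    simp only [Function.comp]
    rw [← hper]
    congr 1
    ring
  rw [aux_ibp _ _ _ (aux_phi_deriv z hz) hk' 0 (2 * Real.pi) (by positivity)]
  simp only [hl]
  set c := Function.leftLim β 0
  rw [hl2]
  have hae : ∀ᵐ s : ℝ, Function.leftLim β s = β s := by
    have : {s | ¬ ContinuousAt β s}.Countable := hmono.countable_not_continuousAt
    filter_upwards [this.ae_notMem volume] with s hs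
    simp only [mem_ofPred_eq, not_not] at hs
    exact hs.continuousWithinAt.leftLim_eq
  have e1 : ∫ s in (0:ℝ)..(2 * Real.pi), Complex.I * (z / (Complex.exp (s * Complex.I) - z)) *
        ((Function.leftLim β s - c : ℝ) : ℂ)
      = ∫ s in (0:ℝ)..(2 * Real.pi), (Complex.I * (((β s - s : ℝ) : ℂ) * (z / (Complex.exp (s * Complex.I) - z)))
        + (Complex.I * (z / (Complex.exp (s * Complex.I) - z))) * (s - c)) := by
    apply intervalIntegral.integral_congr_ae
    filter_upwards [hae] with s hs _
    rw [hs]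
    push_cast
    ring
  have hphi2 : Complex.log (1 - Complex.exp (-((2 * Real.pi : ℝ) : ℂ) * Complex.I) * z) = Complex.log (1 - z) := by
    have : Complex.exp (-((2 * Real.pi : ℝ) : ℂ) * Complex.I) = 1 := by
      push_cast
      rw [neg_mul, Complex.exp_neg, Complex.exp_two_pi_mul_I, inv_one]
    rw [this, one_mul]
  have e2 : ∫ s in (0:ℝ)..(2 * Real.pi), (Complex.I * (z / (Complex.exp (s * Complex.I) - z))) * (s - c)
      = Complex.log (1 - z) * (2 * Real.pi) := by
    have := intervalIntegral.integral_mul_deriv_eq_deriv_mul (a := 0) (b := 2 * Real.pi)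
      (u := fun s : ℝ => (s - c : ℂ)) (u' := fun _ => 1)
      (v := fun t : ℝ => Complex.log (1 - Complex.exp (-(t:ℂ) * Complex.I) * z))
      (fun s _ => (Complex.ofRealCLM.hasDerivAt (x := s)).sub_const _)
      (fun s _ => aux_phi_deriv z hz s) (by simp) (hk'.intervalIntegrable _ _)
    simp only [one_mul] at this
    rw [aux_log_mean z hz, hphi2] at this
    simp only [mul_comm (Complex.I * _)]
    rw [this]
    simp
    ring
  rw [e1, intervalIntegral.integral_add, e2, intervalIntegral.integral_const_mul, hphi2]
  · push_cast; ring
  · apply IntervalIntegrable.const_mul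
    apply IntervalIntegrable.mul_continuousOn _ hk.continuousOn
    have h1 : IntervalIntegrable (fun t => β t - t) volume 0 (2 * Real.pi) :=
      (hmono.intervalIntegrable).sub (continuous_id.intervalIntegrable _ _)
    exact ⟨h1.1.ofReal, h1.2.ofReal⟩
  · apply Continuous.intervalIntegrable
    fun_prop

lemma aux_limit (G : ℂ → ℂ) (hG : DifferentiableOn ℂ G (ball 0 1)) (hG0 : G 0 = 0)
    (β : ℝ → ℝ)
    (hpos : ∀ w ∈ ball (0:ℂ) 1, 0 ≤ 1 + (w * deriv G w).re)
    (hβ : ∀ t : ℝ, Tendsto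
        (fun r : ℝ => (G ((r : ℂ) * Complex.exp ((t : ℂ) * Complex.I))).im + t)
        (𝓝[<] 1) (𝓝 (β t))) (z : ℂ) (hz : ‖z‖ < 1) :
    ∫ t in (0:ℝ)..(2 * Real.pi), ((β t - t : ℝ) : ℂ) *
      (z / (Complex.exp (t * Complex.I) - z)) = - Complex.I * Real.pi * G z := by
  have hk := aux_kernel_cont z hz
  have hpi := Real.pi_pos
  have hmem : ∀ r ∈ Ioo (0:ℝ) 1, ∀ t : ℝ, (r : ℂ) * Complex.exp ((t : ℂ) * Complex.I) ∈ ball (0:ℂ) 1 := by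
    intro r hr t
    simp [abs_of_pos hr.1, hr.2]
  have hIoo : Ioo (0:ℝ) 1 ∈ 𝓝[<] (1:ℝ) := Ioo_mem_nhdsLT one_pos
  have hUmono : ∀ r ∈ Ioo (0:ℝ) 1,
      Monotone fun t : ℝ => (G ((r : ℂ) * Complex.exp ((t : ℂ) * Complex.I))).im + t := by
    intro r hr
    apply monotone_of_hasDerivAt_nonneg (f' := fun t : ℝ =>
      1 + (((r : ℂ) * Complex.exp ((t : ℂ) * Complex.I)) * deriv G ((r : ℂ) * Complex.exp ((t : ℂ) * Complex.I))).re)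
    · intro t
      have h0 : HasDerivAt (fun t : ℝ => (r : ℂ) * Complex.exp ((t : ℂ) * Complex.I))
          ((r : ℂ) * (Complex.exp ((t : ℂ) * Complex.I) * (1 * Complex.I))) t :=
        (((Complex.ofRealCLM.hasDerivAt (x := t)).mul_const _).cexp).const_mul _
      have h1 := (hG.differentiableAt (isOpen_ball.mem_nhds (hmem r hr t))).hasDerivAt
      have h2 := HasDerivAt.comp_of_eq t h1 h0 rfl
      have h3 := (Complex.imCLM.hasFDerivAt.comp_hasDerivAt t h2).add (hasDerivAt_id t)
      refine HasDerivAt.congr_deriv h3 ?_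
      symm
      rw [add_comm]
      congr 1
      simp only [Complex.imCLM_apply, one_mul]
      rw [← Complex.I_mul_im]
      congr 1
      ring
    · intro t
      exact hpos _ (hmem r hr t)
  have hlim : Tendsto (fun r : ℝ => ∫ t in (0:ℝ)..(2 * Real.pi),
      ((G ((r : ℂ) * Complex.exp ((t : ℂ) * Complex.I))).im : ℂ) * (z / (Complex.exp (t * Complex.I) - z)))
      (𝓝[<] 1) (𝓝 (∫ t in (0:ℝ)..(2 * Real.pi), ((β t - t : ℝ) : ℂ) *
      (z / (Complex.exp (t * Complex.I) - z)))) := by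
    apply intervalIntegral.tendsto_integral_filter_of_dominated_convergence
      (fun t => (|β 0| + 1 + 4 * Real.pi) * ‖z / (Complex.exp (t * Complex.I) - z)‖)
    · filter_upwards [hIoo] with r hr
      apply Continuous.aestronglyMeasurable
      refine Continuous.mul ?_ hk
      apply Complex.continuous_ofReal.comp
      apply Complex.continuous_im.comp
      exact hG.continuousOn.comp_continuous (by fun_prop) (hmem r hr)
    · have h1 : ∀ᶠ r : ℝ in 𝓝[<] (1:ℝ), |(G ((r : ℂ) * Complex.exp (((0:ℝ) : ℂ) * Complex.I))).im + (0:ℝ) - β 0| < 1 := by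
        have := (hβ 0).eventually (Metric.ball_mem_nhds (β 0) one_pos)
        simpa only [Metric.mem_ball, Real.dist_eq] using this
      filter_upwards [hIoo, h1] with r hr hr1
      refine Eventually.of_forall fun t ht => ?_
      rw [uIoc_of_le (by positivity)] at ht
      rw [norm_mul]
      gcongr
      rw [Complex.norm_real, Real.norm_eq_abs]
      have m1 := hUmono r hr (a := (0:ℝ)) (b := t) ht.1.le
      have m2 := hUmono r hr ht.2
      have e : Complex.exp (((2 * Real.pi : ℝ) : ℂ) * Complex.I) = Complex.exp (((0 : ℝ) : ℂ) * Complex.I) := by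
        push_cast
        rw [Complex.exp_two_pi_mul_I]; simp
      simp only [e] at m1 m2
      have := neg_abs_le (β 0)
      have := le_abs_self (β 0)
      rw [abs_lt] at hr1
      rw [abs_le]
      constructor <;> linarith [ht.1, ht.2]
    · apply Continuous.intervalIntegrable
      exact continuous_const.mul hk.norm
    · refine Eventually.of_forall fun t _ => ?_
      apply Tendsto.mul_const
      apply (Complex.continuous_ofReal.tendsto _).comp
      have := (hβ t).sub_const t
      simpa using this
  have hlim2 : Tendsto (fun r : ℝ => - Complex.I * Real.pi * G (r * z)) (𝓝[<] 1)
      (𝓝 (- Complex.I * Real.pi * G z)) := by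
    apply Tendsto.const_mul
    have h1 : ContinuousAt G z := (hG.differentiableAt (isOpen_ball.mem_nhds (by simpa using hz))).continuousAt
    apply h1.tendsto.comp
    apply tendsto_nhdsWithin_of_tendsto_nhds
    have : Continuous fun r : ℝ => (r : ℂ) * z := by fun_prop
    simpa using this.tendsto 1
  refine tendsto_nhds_unique hlim (hlim2.congr' ?_)
  filter_upwards [hIoo] with r hr
  have := aux_schwarz (fun w => G (r * w)) (1 / r) (by rw [lt_div_iff₀ hr.1]; linarith [hr.2]) (by
    apply hG.comp (by fun_prop)
    intro w hw
    simp only [mem_ball, dist_zero_right, norm_mul, Complex.norm_real, Real.norm_eq_abs, abs_of_pos hr.1] at *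
    rw [lt_div_iff₀ hr.1] at hw
    linarith) z hz
  rw [this]
  simp [hG0]

/-- Representation Theorem, direct part: for `f ∈ F_λ` with boundary
angle function `β(t) = lim_{r→1−} u_f(r e^{it}) + t` (non-decreasing, `2π`-periodic in
the appropriate sense), one has
`f(z) = z·exp(−(e^{iλ} cos λ / π) ∫_{[0,2π)} Log(1 − e^{−it}z) dμ_β(t))` on the disk. -/
theorem spirallike_representation (lam : ℝ)
    (hlam : lam ∈ Set.Ioo (-(Real.pi / 2)) (Real.pi / 2))
    (f : ℂ → ℂ) (hf : f ∈ SpiralClass lam) (L : ℂ → ℂ) (hL : IsLogBranch f L)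
    (β : ℝ → ℝ) (hmono : Monotone β)
    (hper : ∀ t : ℝ, β (t + 2 * Real.pi) = β t + 2 * Real.pi)
    (hβ : ∀ t : ℝ, Tendsto
        (fun r : ℝ => lambdaArgBranch lam L ((r : ℂ) * Complex.exp ((t : ℂ) * Complex.I)) + t)
        (𝓝[<] 1) (𝓝 (β t))) :
    ∀ z ∈ ball (0 : ℂ) 1,
      f z = z * Complex.exp
        (-(Complex.exp ((lam : ℂ) * Complex.I) * (Real.cos lam : ℂ) / (Real.pi : ℂ)) *
          ∫ t in Set.Ico (0 : ℝ) (2 * Real.pi),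
            Complex.log (1 - Complex.exp (-(t : ℂ) * Complex.I) * z)
              ∂hmono.stieltjesFunction.measure) := by
  intro z hz
  obtain ⟨hfd, hf0, hf1, hfne, hfre⟩ := hf
  obtain ⟨hLd, hL0, hLe⟩ := hL
  have hcos : 0 < Real.cos lam := Real.cos_pos_of_mem_Ioo hlam
  have hcos' : (Real.cos lam : ℂ) ≠ 0 := by exact_mod_cast hcos.ne'
  have hpi : (Real.pi : ℂ) ≠ 0 := by exact_mod_cast Real.pi_ne_zero
  have hz1 : ‖z‖ < 1 := by simpa using hz
  have hfeq : ∀ w ∈ ball (0 : ℂ) 1, f w = w * Complex.exp (L w) := by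
    intro w hw
    by_cases h : w = 0
    · simp [h, hf0]
    · rw [hLe w hw h]; field_simp
  set a : ℂ := 1 - Real.tan lam * Complex.I with ha
  have hacos : a * Real.cos lam = Complex.exp (-(lam : ℂ) * Complex.I) := by
    rw [ha, Complex.exp_mul_I, Complex.cos_neg, Complex.sin_neg, Real.tan_eq_sin_div_cos]
    push_cast at hcos' ⊢
    field_simp
    ring
  have hLu : ∀ w, lambdaArgBranch lam L w = (a * L w).im := by
    intro w
    simp [lambdaArgBranch, ha, Complex.mul_im, -Complex.ofReal_tan]
    ring
  have hpos : ∀ w ∈ ball (0:ℂ) 1, 0 ≤ 1 + (w * deriv (fun w => a * L w) w).re := by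
    intro w hw
    by_cases h : w = 0
    · simp [h]
    have hLw := (hLd.differentiableAt (isOpen_ball.mem_nhds hw)).hasDerivAt
    have hdf : deriv f w = Complex.exp (L w) + w * (Complex.exp (L w) * deriv L w) := by
      have h1 : f =ᶠ[𝓝 w] fun w => w * Complex.exp (L w) := by
        filter_upwards [isOpen_ball.mem_nhds hw] with x hx using hfeq x hx
      rw [h1.deriv_eq]
      have := (hasDerivAt_id w).mul hLw.cexp
      refine Eq.trans (this.deriv) ?_
      simp
    have h2 := hfre w hw h
    have h3 : Complex.exp (-(lam : ℂ) * Complex.I) * w * deriv f w / f w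
        = (Real.cos lam : ℂ) * (a + w * (a * deriv L w)) := by
      rw [← hacos, hdf, hfeq w hw]
      have := Complex.exp_ne_zero (L w)
      field_simp
    rw [h3, Complex.re_ofReal_mul] at h2
    have h4 := (pos_iff_pos_of_mul_pos h2).1 hcos
    rw [(hLw.const_mul a).deriv]
    have h5 : a.re = 1 := by simp [ha]
    rw [Complex.add_re, h5] at h4
    exact h4.le
  have key := aux_limit (fun w => a * L w) (hLd.const_mul a) (by simp [hL0]) β hpos
    (by simpa only [hLu] using hβ) z hz1
  rw [aux_stieltjes β hmono hper z hz1, key, hfeq z hz]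
  congr 2
  have hexp : Complex.exp ((lam : ℂ) * Complex.I) * Complex.exp (-(lam : ℂ) * Complex.I) = 1 := by
    rw [← Complex.exp_add]; simp
  rw [← hacos] at hexp
  field_simp
  linear_combination (-(L z)) * hexp + (L z) * (Complex.exp ((lam : ℂ) * Complex.I) * a * Real.cos lam) * Complex.I_sq
end

section
/- Let λ ∈ (−π/2, π/2) and f ∈ F_λ. Then for every t ∈ ℝ the radial limit lim_{r→1−} f(r e^{it}) exists in the Riemann sphere ℂ ∪ {∞} (i.e. the limit exists in the one-point compactification of ℂ, possibly equal to ∞). -/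
open Set Metric Filter Topology

section Helpers

lemma schwarz_im (p : ℂ → ℂ) (R : ℝ) (hR : 0 < R) (hp : DiffContOnCl ℂ p (ball 0 R))
    (w : ℂ) (hw : w ∈ ball (0:ℂ) R) :
    (p w).im - (p 0).im =
      Real.circleAverage (fun z => (herglotzRieszKernel 0 w z).im * (p z).re) 0 R := by
  have hc : ContinuousOn p (sphere 0 |R|) := by
    rw [abs_of_pos hR]
    exact hp.2.mono (by rw [closure_ball _ hR.ne']; exact sphere_subset_closedBall)
  have hK : ContinuousOn (herglotzRieszKernel 0 w) (sphere 0 |R|) :=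
    continuousOn_herglotzRieszKernel_sphere hw
  have h1 := hp.circleAverage_re_herglotzRieszKernel_smul hw
  have hp' : DiffContOnCl ℂ p (ball 0 |R|) := by rwa [abs_of_pos hR]
  have hw' : w ∈ ball (0:ℂ) |R| := by rwa [abs_of_pos hR]
  have h2 := hp'.circleAverage_smul_div hw'
  have h3 := hp'.circleAverage
  have ci : ∀ {q : ℂ → ℂ}, ContinuousOn q (sphere 0 |R|) → CircleIntegrable q 0 R :=
    fun h => ContinuousOn.circleIntegrable' h
  have hne : ∀ z ∈ sphere (0:ℂ) |R|, z - w ≠ 0 := by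
    intro z hz h
    rw [sub_eq_zero] at h
    subst h
    simp at hz hw'
    linarith
  have hq : ContinuousOn (fun z => ((z - 0) / (z - w)) • p z) (sphere 0 |R|) := by
    have : ContinuousOn (fun z => ((z - 0) / (z - w))) (sphere 0 |R|) :=
      ContinuousOn.div (by fun_prop) (by fun_prop) hne
    exact this.smul hc
  have hk1 : ContinuousOn ((Complex.re ∘ herglotzRieszKernel 0 w) • p) (sphere 0 |R|) :=
    ContinuousOn.smul (Complex.continuous_re.comp_continuousOn hK) hc
  have hk2 : ContinuousOn (fun z => (((herglotzRieszKernel 0 w z).im : ℂ)) * p z)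
      (sphere 0 |R|) :=
    ContinuousOn.mul (Complex.continuous_ofReal.comp_continuousOn
      (Complex.continuous_im.comp_continuousOn hK)) hc
  have h4 : Complex.I * Real.circleAverage
      (fun z => (((herglotzRieszKernel 0 w z).im : ℂ)) * p z) 0 R = p w - p 0 := by
    have e1 : Real.circleAverage ((Complex.re ∘ herglotzRieszKernel 0 w) • p
        + Complex.I • (fun z => (((herglotzRieszKernel 0 w z).im : ℂ)) * p z)) 0 R
        = Real.circleAverage ((2:ℂ) • (fun z => (((z - 0) / (z - w)) • p z)) - p) 0 R := by
      apply Real.circleAverage_congr_sphere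
      intro z hz
      have := hne z hz
      have e2 : (((herglotzRieszKernel 0 w z).re : ℂ)) + Complex.I * (herglotzRieszKernel 0 w z).im
        = herglotzRieszKernel 0 w z := by
        rw [mul_comm]; exact Complex.re_add_im _
      have e3 : herglotzRieszKernel 0 w z = 2 * (z / (z - w)) - 1 := by
        rw [herglotzRieszKernel_def]; simp only [sub_zero]; field_simp; ring
      simp only [Pi.add_apply, Pi.sub_apply, Pi.smul_apply', Pi.smul_apply, Function.comp, Complex.real_smul,
        smul_eq_mul, sub_zero]
      rw [← mul_assoc, ← add_mul, e2, e3]; ring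
    rw [Real.circleAverage_add (ci hk1) (ci (hk2.const_smul Complex.I)),
      Real.circleAverage_sub (ci (hq.const_smul (2:ℂ))) (ci hc),
      Real.circleAverage_smul, Real.circleAverage_smul, h1, h2, h3] at e1
    simp only [smul_eq_mul] at e1
    linear_combination e1
  have h5 := Complex.reCLM.circleAverage_comp_comm (ci hk2)
  have h6 : (Complex.reCLM ∘ fun z => (((herglotzRieszKernel 0 w z).im : ℂ)) * p z)
     = (fun z => (herglotzRieszKernel 0 w z).im * (p z).re) := by
    ext z; simp
  rw [h6] at h5
  rw [h5]
  have := congrArg Complex.im h4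
  simpa using this.symm

lemma kernel_bound (z : ℂ) (r : ℝ) (h0 : 0 ≤ r) (h1 : r ≤ 1) :
    |(herglotzRieszKernel 0 r z).im| ≤ 2 * (|z.im| / ((r - z.re) ^ 2 + z.im ^ 2)) := by
  rw [herglotzRieszKernel_def]
  have e : ((z - 0 + ((r:ℂ) - 0)) / (z - 0 - ((r:ℂ) - 0))).im
      = (-2 * r * z.im) / ((r - z.re) ^ 2 + z.im ^ 2) := by
    rw [Complex.div_im]
    simp [Complex.normSq_apply]
    rw [← sub_div]
    congr 1 <;> ring
  rw [e, abs_div, abs_of_nonneg (by positivity : (0:ℝ) ≤ (r - z.re) ^ 2 + z.im ^ 2), abs_mul,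
    abs_mul, abs_of_nonneg h0, ← mul_div_assoc]
  gcongr
  norm_num
  nlinarith [abs_nonneg z.im]

lemma arctan_bound (A B a b : ℝ) :
    ∫ r in a..b, |B| / ((r - A) ^ 2 + B ^ 2) ≤ Real.pi := by
  by_cases hB : B = 0
  · simp [hB, Real.pi_pos.le]
  have hB' : 0 < |B| := abs_pos.2 hB
  have hpos : ∀ r : ℝ, 0 < (r - A) ^ 2 + B ^ 2 := fun r => by positivity
  have hd : ∀ r ∈ uIcc a b, HasDerivAt (fun r => Real.arctan ((r - A) / |B|))
      (|B| / ((r - A) ^ 2 + B ^ 2)) r := by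
    intro r _
    have := (((hasDerivAt_id' r).sub_const A).div_const |B|).arctan
    convert this using 1
    have := hpos r
    rw [← sq_abs B] at *
    field_simp
    ring
  rw [intervalIntegral.integral_eq_sub_of_hasDerivAt hd]
  · have := Real.arctan_lt_pi_div_two ((b - A) / |B|)
    have := Real.neg_pi_div_two_lt_arctan ((a - A) / |B|)
    linarith
  · apply Continuous.intervalIntegrable
    exact Continuous.div (by fun_prop) (by fun_prop) (fun r => (hpos r).ne')

open MeasureTheory

lemma im_integral_bound (p : ℂ → ℂ) (hp : DifferentiableOn ℂ p (ball 0 1))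
    (hre : ∀ z ∈ ball (0:ℂ) 1, 0 ≤ (p z).re) (b : ℝ) (hb0 : 0 ≤ b) (hb : b < 1) :
    ∫ r in (0:ℝ)..b, |(p r).im - (p 0).im| ≤ 2 * Real.pi * (p 0).re := by
  obtain ⟨R, hbR, hR1⟩ := exists_between hb
  have hR : 0 < R := hb0.trans_lt hbR
  have hpc : ContinuousOn p (closedBall 0 R) :=
    hp.continuousOn.mono (closedBall_subset_ball hR1)
  have hdc : DiffContOnCl ℂ p (ball 0 R) :=
    ⟨hp.mono (ball_subset_ball hR1.le), by rwa [closure_ball _ hR.ne']⟩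
  have hcm : ∀ s, circleMap 0 R s ∈ closedBall (0:ℂ) R := fun s => by
    simp [abs_of_pos hR]
  have hpcirc : Continuous (fun s => p (circleMap 0 R s)) :=
    hpc.comp_continuous (continuous_circleMap 0 R) hcm
  have hpre : ∀ s, 0 ≤ (p (circleMap 0 R s)).re := fun s =>
    hre _ (closedBall_subset_ball hR1 (hcm s))
  let k : ℝ → ℝ → ℝ := fun r s => 2 * (|(circleMap 0 R s).im| /
    ((r - (circleMap 0 R s).re) ^ 2 + (circleMap 0 R s).im ^ 2)) * (p (circleMap 0 R s)).re
  have hden : ∀ r ∈ Icc 0 b, ∀ s,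
      (r - (circleMap 0 R s).re) ^ 2 + (circleMap 0 R s).im ^ 2 ≠ 0 := by
    intro r hr s h
    have h1 : (r - (circleMap 0 R s).re) ^ 2 = 0 := by
      nlinarith [sq_nonneg (r - (circleMap 0 R s).re), sq_nonneg (circleMap 0 R s).im]
    have h2 : (circleMap 0 R s).im ^ 2 = 0 := by nlinarith
    have h3 : ‖circleMap 0 R s‖ = R := by simp [abs_of_pos hR]
    have h4 := Complex.sq_norm (circleMap 0 R s)
    rw [h3, Complex.normSq_apply] at h4
    have h5 : r = (circleMap 0 R s).re := by nlinarith [pow_eq_zero_iff (two_ne_zero) |>.1 h1]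
    rw [← h5] at h4
    nlinarith [hr.1, hr.2]
  have hcmc : Continuous (fun x : ℝ × ℝ => circleMap 0 R x.2) :=
    (continuous_circleMap 0 R).comp continuous_snd
  have hre' := Complex.continuous_re.comp hcmc
  have him' := Complex.continuous_im.comp hcmc
  have hpp := Complex.continuous_re.comp (hpcirc.comp (continuous_snd (X := ℝ)))
  have hk : ContinuousOn (Function.uncurry k) (Icc 0 b ×ˢ univ) := by
    apply ContinuousOn.mul _ hpp.continuousOn
    apply ContinuousOn.mul continuousOn_const
    apply ContinuousOn.div him'.abs.continuousOn
    · exact (((continuous_fst.sub hre').pow 2).add (him'.pow 2)).continuousOn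
    · intro x hx
      exact hden x.1 hx.1 x.2
  have hint : IntegrableOn (Function.uncurry k) (uIoc 0 b ×ˢ uIoc 0 (2 * Real.pi)) := by
    have : IntegrableOn (Function.uncurry k) (Icc 0 b ×ˢ Icc 0 (2 * Real.pi)) :=
      (hk.mono (prod_mono_right (subset_univ _))).integrableOn_compact
        (isCompact_Icc.prod isCompact_Icc)
    refine this.mono_set (prod_mono ?_ ?_)
    · rw [uIoc_of_le hb0]; exact Ioc_subset_Icc_self
    · rw [uIoc_of_le Real.two_pi_pos.le]; exact Ioc_subset_Icc_self
  have hswap := intervalIntegral_intervalIntegral_swap hint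
  have hks : ∀ r ∈ Icc 0 b, Continuous (fun s => k r s) := by
    intro r hr
    exact hk.comp_continuous (f := fun s => (r, s)) (by fun_prop) (fun s => ⟨hr, mem_univ _⟩)
  have hprc : ContinuousOn (fun r : ℝ => p r) (Icc 0 b) := by
    apply hpc.comp Complex.continuous_ofReal.continuousOn
    intro r hr
    simp [abs_of_nonneg hr.1]
    linarith [hr.2]
  -- pointwise bound
  have hpt : ∀ r ∈ Icc 0 b, |(p r).im - (p 0).im| ≤
      (2 * Real.pi)⁻¹ * ∫ s in (0:ℝ)..(2 * Real.pi), k r s := by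
    intro r hr
    have hw : (r : ℂ) ∈ ball (0:ℂ) R := by
      simp [abs_of_nonneg hr.1]; linarith [hr.2]
    rw [schwarz_im p R hR hdc r hw, Real.circleAverage_def, smul_eq_mul, abs_mul,
      abs_of_pos (inv_pos.2 Real.two_pi_pos)]
    gcongr
    refine (intervalIntegral.abs_integral_le_integral_abs Real.two_pi_pos.le).trans ?_
    apply intervalIntegral.integral_mono_on Real.two_pi_pos.le
    · apply Continuous.intervalIntegrable
      apply Continuous.abs
      apply Continuous.mul _ (Complex.continuous_re.comp hpcirc)
      apply Complex.continuous_im.comp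
      refine (continuousOn_herglotzRieszKernel_sphere hw).comp_continuous
        (continuous_circleMap 0 R) (fun s => by simp)
    · exact (hks r hr).intervalIntegrable _ _
    · intro s _
      rw [abs_mul, abs_of_nonneg (hpre s)]
      exact mul_le_mul_of_nonneg_right (kernel_bound _ r hr.1 (by linarith [hr.2])) (hpre s)
  have hin : IntervalIntegrable (fun r => ∫ s in (0:ℝ)..(2 * Real.pi), k r s) volume 0 b := by
    rw [intervalIntegrable_iff]
    have h := hint
    rw [IntegrableOn, Measure.volume_eq_prod, ← Measure.prod_restrict] at h
    have h2 := h.integral_prod_left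
    rw [IntegrableOn]
    simp only [intervalIntegral.integral_of_le Real.two_pi_pos.le]
    rw [uIoc_of_le Real.two_pi_pos.le] at h2
    exact h2
  have hin2 : IntervalIntegrable (fun s => ∫ r in (0:ℝ)..b, k r s) volume 0 (2 * Real.pi) := by
    rw [intervalIntegrable_iff]
    have h := hint
    rw [IntegrableOn, Measure.volume_eq_prod, ← Measure.prod_restrict] at h
    have h2 := h.integral_prod_right
    rw [IntegrableOn]
    simp only [intervalIntegral.integral_of_le hb0]
    rw [uIoc_of_le hb0] at h2
    exact h2
  calc ∫ r in (0:ℝ)..b, |(p r).im - (p 0).im|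
      ≤ ∫ r in (0:ℝ)..b, (2 * Real.pi)⁻¹ * ∫ s in (0:ℝ)..(2 * Real.pi), k r s := by
        apply intervalIntegral.integral_mono_on hb0 _ (hin.const_mul _) hpt
        apply ContinuousOn.intervalIntegrable
        rw [uIcc_of_le hb0]
        exact ((Complex.continuous_im.comp_continuousOn hprc).sub continuousOn_const).abs
    _ = (2 * Real.pi)⁻¹ * ∫ s in (0:ℝ)..(2 * Real.pi), ∫ r in (0:ℝ)..b, k r s := by
        rw [intervalIntegral.integral_const_mul, hswap]
    _ ≤ (2 * Real.pi)⁻¹ * ∫ s in (0:ℝ)..(2 * Real.pi),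
          (2 * Real.pi) * (p (circleMap 0 R s)).re := by
        have := Real.pi_pos
        gcongr
        apply intervalIntegral.integral_mono_on Real.two_pi_pos.le hin2
        · exact (continuous_const.mul (Complex.continuous_re.comp hpcirc)).intervalIntegrable _ _
        · intro s _
          simp only [k]
          rw [intervalIntegral.integral_mul_const, intervalIntegral.integral_const_mul]
          have := arctan_bound (circleMap 0 R s).re (circleMap 0 R s).im 0 b
          have := hpre s
          gcongr
    _ = 2 * Real.pi * (p 0).re := by
        have h3 := (show DiffContOnCl ℂ p (ball 0 |R|) by rwa [abs_of_pos hR]).circleAverage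
        have h4 := Complex.reCLM.circleAverage_comp_comm (f := p) (c := 0) (R := R)
          (hpcirc.intervalIntegrable _ _)
        rw [h3, Real.circleAverage_def] at h4
        simp only [Function.comp, Complex.reCLM_apply, smul_eq_mul] at h4
        rw [intervalIntegral.integral_const_mul, ← h4]
        ring

lemma im_integrable (p : ℂ → ℂ) (hp : DifferentiableOn ℂ p (ball 0 1))
    (hre : ∀ z ∈ ball (0:ℂ) 1, 0 ≤ (p z).re) :
    IntegrableOn (fun r : ℝ => (p r).im - (p 0).im) (Ioc 0 1) := by
  have hb : Tendsto (fun n : ℕ => 1 - 1 / ((n:ℝ) + 1)) atTop (𝓝 1) := by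
    simpa using tendsto_one_div_add_atTop_nhds_zero_nat (𝕜 := ℝ) |>.const_sub 1
  have h0 : ∀ n : ℕ, 0 ≤ 1 - 1 / ((n:ℝ) + 1) := fun n => by
    rw [sub_nonneg, div_le_one (by positivity)]; linarith [n.cast_nonneg (α := ℝ)]
  have h1 : ∀ n : ℕ, 1 - 1 / ((n:ℝ) + 1) < 1 := fun n => by
    have : 0 < 1 / ((n:ℝ) + 1) := by positivity
    linarith
  refine integrableOn_Ioc_of_intervalIntegral_norm_bounded_right
    (I := 2 * Real.pi * (p 0).re) (fun n => ?_) hb (Eventually.of_forall fun n => ?_)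
  · refine IntegrableOn.mono_set (ContinuousOn.integrableOn_compact isCompact_Icc ?_)
      Ioc_subset_Icc_self
    refine ContinuousOn.sub ?_ continuousOn_const
    apply Complex.continuous_im.comp_continuousOn
    apply hp.continuousOn.comp Complex.continuous_ofReal.continuousOn
    intro r hr
    simp only [mem_ball, dist_zero_right, Complex.norm_real, Real.norm_eq_abs, abs_of_nonneg hr.1]
    linarith [hr.2, h1 n]
  · have := im_integral_bound p hp hre _ (h0 n) (h1 n)
    rw [intervalIntegral.integral_of_le (h0 n)] at this
    exact this

lemma monotone_limit (G : ℝ → ℝ) (hG : MonotoneOn G (Ioo (1/2) 1)) :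
    (∃ a, Tendsto G (𝓝[<] 1) (𝓝 a)) ∨ Tendsto G (𝓝[<] 1) atTop := by
  by_cases hb : BddAbove (G '' Ioo (1/2) 1)
  · exact Or.inl ⟨_, hG.tendsto_nhdsWithin_Ioo_left (by norm_num) hb⟩
  · right
    rw [Filter.tendsto_atTop]
    intro M
    rw [not_bddAbove_iff] at hb
    obtain ⟨_, ⟨x, hx, rfl⟩, hM⟩ := hb M
    filter_upwards [Ioo_mem_nhdsLT hx.2] with y hy
    exact hM.le.trans (hG hx ⟨hx.1.trans hy.1, hy.2⟩ hy.1.le)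

lemma limit_of_ode (lam : ℝ) (hc : 0 < Real.cos lam) (g p : ℂ → ℂ)
    (hg : DifferentiableOn ℂ g (ball 0 1))
    (hg0 : ∀ z ∈ ball (0:ℂ) 1, z ≠ 0 → g z ≠ 0)
    (hp : DifferentiableOn ℂ p (ball 0 1))
    (hre : ∀ z ∈ ball (0:ℂ) 1, 0 ≤ (p z).re)
    (hode : ∀ z ∈ ball (0:ℂ) 1, z ≠ 0 →
      deriv g z = Complex.exp (lam * Complex.I) * (p z / z) * g z) :
    ∃ w : OnePoint ℂ, Tendsto (fun r : ℝ => (g r : OnePoint ℂ)) (𝓝[<] 1) (𝓝 w) := by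
  have hball : ∀ r ∈ Ico (1/2 : ℝ) 1, (r : ℂ) ∈ ball (0:ℂ) 1 := by
    intro r hr
    simp only [mem_ball, dist_zero_right, Complex.norm_real, Real.norm_eq_abs]
    rw [abs_of_nonneg (by linarith [hr.1])]; exact hr.2
  have hball' : ∀ r ∈ Ioo (0 : ℝ) 1, (r : ℂ) ∈ ball (0:ℂ) 1 := by
    intro r hr
    simp only [mem_ball, dist_zero_right, Complex.norm_real, Real.norm_eq_abs]
    rw [abs_of_nonneg (by linarith [hr.1])]; exact hr.2
  have hpc : ContinuousOn (fun r : ℝ => p r) (Ioo 0 1) :=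
    hp.continuousOn.comp Complex.continuous_ofReal.continuousOn hball'
  have hrec : ContinuousOn (fun r : ℝ => (p r).re / r) (Ioo 0 1) :=
    (Complex.continuous_re.comp_continuousOn hpc).div continuousOn_id (fun r hr => hr.1.ne')
  have himc : ContinuousOn (fun r : ℝ => (p r).im / r) (Ioo 0 1) :=
    (Complex.continuous_im.comp_continuousOn hpc).div continuousOn_id (fun r hr => hr.1.ne')
  have key : ∀ q : ℝ → ℝ, ContinuousOn q (Ioo 0 1) → ∀ r ∈ Ico (1/2 : ℝ) 1,
      HasDerivAt (fun x => ∫ y in (1/2 : ℝ)..x, q y) (q r) r := by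
    intro q hq r hr
    have hsub : Icc (1/2) r ⊆ Ioo (0:ℝ) 1 := fun x hx =>
      ⟨by linarith [hx.1], by linarith [hx.2, hr.2]⟩
    have hr' : r ∈ Ioo (0:ℝ) 1 := hsub ⟨hr.1, le_rfl⟩
    refine intervalIntegral.integral_hasDerivAt_right ?_ ?_ ?_
    · apply ContinuousOn.intervalIntegrable
      rw [uIcc_of_le hr.1]
      exact hq.mono hsub
    · exact hq.stronglyMeasurableAtFilter isOpen_Ioo r hr'
    · exact hq.continuousAt (isOpen_Ioo.mem_nhds hr')
  set G : ℝ → ℝ := fun x => ∫ y in (1/2 : ℝ)..x, (p y).re / y with hGdef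
  set H : ℝ → ℝ := fun x => ∫ y in (1/2 : ℝ)..x, (p y).im / y with hHdef
  have hGd := key _ hrec
  have hHd := key _ himc
  have hGmono : MonotoneOn G (Ioo (1/2) 1) := by
    apply monotoneOn_of_deriv_nonneg (convex_Ioo _ _)
    · intro r hr
      exact (hGd r ⟨hr.1.le, hr.2⟩).continuousAt.continuousWithinAt
    · intro r hr
      rw [interior_Ioo] at hr
      exact (hGd r ⟨hr.1.le, hr.2⟩).differentiableAt.differentiableWithinAt
    · intro r hr
      rw [interior_Ioo] at hr
      rw [(hGd r ⟨hr.1.le, hr.2⟩).deriv]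
      exact div_nonneg (hre _ (hball r ⟨hr.1.le, hr.2⟩)) (by linarith [hr.1])
  have hHlim : ∃ b, Tendsto H (𝓝[<] 1) (𝓝 b) := by
    have h1 := im_integrable p hp hre
    have h2 : IntegrableOn (fun r : ℝ => (p r).im) (Icc (1/2) 1) := by
      rw [integrableOn_Icc_iff_integrableOn_Ioc]
      have h3 : IntegrableOn (fun r : ℝ => (p r).im - (p 0).im) (Ioc (1/2) 1) :=
        h1.mono_set (Ioc_subset_Ioc_left (by norm_num))
      have h4 : IntegrableOn (fun _ : ℝ => (p 0).im) (Ioc (1/2) 1) :=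
        integrableOn_const (by simp)
      have := h3.add h4
      refine this.congr_fun (fun x _ => by simp) measurableSet_Ioc
    have h5 : IntegrableOn (fun r : ℝ => (p r).im / r) (Icc (1/2) 1) := by
      have : ContinuousOn (fun r : ℝ => r⁻¹) (Icc (1/2) 1) :=
        continuousOn_id.inv₀ (fun r hr => by
          have := hr.1
          simp only [id]; intro h; linarith)
      simpa only [div_eq_mul_inv] using h2.mul_continuousOn this isCompact_Icc
    have h6 := intervalIntegral.continuousOn_primitive_interval
      (a := (1/2:ℝ)) (b := 1) (by rwa [uIcc_of_le (by norm_num)])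
    rw [uIcc_of_le (by norm_num)] at h6
    refine ⟨H 1, ?_⟩
    have h7 := h6 1 ⟨by norm_num, le_rfl⟩
    have h8 : Tendsto H (𝓝[Ioo (1/2) 1] 1) (𝓝 (H 1)) := h7.mono Ioo_subset_Icc_self
    rwa [nhdsWithin_Ioo_eq_nhdsLT (by norm_num)] at h8
  obtain ⟨b, hb⟩ := hHlim
  set μ : ℂ := Complex.exp (lam * Complex.I) with hμ
  let Φ : ℝ → ℂ := fun r => μ * ((G r : ℂ) + Complex.I * (H r : ℂ))
  have hΦd : ∀ r ∈ Ico (1/2 : ℝ) 1, HasDerivAt Φ (μ * (p r / r)) r := by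
    intro r hr
    have h1 := ((hGd r hr).ofReal_comp.add ((hHd r hr).ofReal_comp.const_mul Complex.I)).const_mul μ
    have h2 : μ * (((((p r).re / r : ℝ)) : ℂ) + Complex.I * (((p r).im / r : ℝ) : ℂ))
        = μ * (p r / r) := by
      conv_rhs => rw [← Complex.re_add_im (p r)]
      push_cast
      ring
    rw [← h2]
    exact h1
  have hgd : ∀ r ∈ Ico (1/2 : ℝ) 1, HasDerivAt (fun x : ℝ => g x) (μ * (p r / r) * g r) r := by
    intro r hr
    have h1 := (hg.differentiableAt (isOpen_ball.mem_nhds (hball r hr))).hasDerivAt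
    rw [hode _ (hball r hr) (by
      have := hr.1
      norm_cast; intro h; linarith)] at h1
    exact h1.comp_ofReal
  have heq : ∀ r ∈ Ico (1/2 : ℝ) 1, g r = g (1/2 : ℝ) * Complex.exp (Φ r) := by
    intro r hr
    have hd : ∀ x ∈ Ico (1/2 : ℝ) 1,
        HasDerivAt (fun x : ℝ => g x * Complex.exp (-Φ x)) 0 x := by
      intro x hx
      have := (hgd x hx).mul (hΦd x hx).neg.cexp
      have h2 : μ * (p x / x) * g x * Complex.exp (-Φ x)
          + g x * (Complex.exp (-Φ x) * (-(μ * (p x / x)))) = 0 := by ring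
      rw [← h2]
      exact this
    have h1 := constant_of_has_deriv_right_zero (a := 1/2) (b := r)
      (f := fun x : ℝ => g x * Complex.exp (-Φ x))
      (fun x hx => (hd x ⟨hx.1, hx.2.trans_lt hr.2⟩).continuousAt.continuousWithinAt)
      (fun x hx => (hd x ⟨hx.1, hx.2.trans hr.2⟩).hasDerivWithinAt) r ⟨hr.1, le_rfl⟩
    have h2 : Φ (1/2) = 0 := by simp [Φ, hGdef, hHdef]
    simp only [h2, neg_zero, Complex.exp_zero, mul_one] at h1
    rw [← h1, mul_assoc, ← Complex.exp_add]
    simp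
  have hev : (fun r : ℝ => g (1/2 : ℝ) * Complex.exp (Φ r)) =ᶠ[𝓝[<] 1] fun r : ℝ => g r := by
    filter_upwards [Ioo_mem_nhdsLT (show (1/2:ℝ) < 1 by norm_num)] with r hr
    exact (heq r ⟨hr.1.le, hr.2⟩).symm
  have hhalf : g (1/2 : ℝ) ≠ 0 := hg0 _ (hball _ ⟨le_rfl, by norm_num⟩) (by norm_num)
  rcases monotone_limit G hGmono with ⟨a, ha⟩ | hinf
  · have h1 : Tendsto (fun r : ℝ => g (1/2 : ℝ) * Complex.exp (Φ r)) (𝓝[<] 1)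
        (𝓝 (g (1/2 : ℝ) * Complex.exp (μ * ((a : ℂ) + Complex.I * (b : ℂ))))) := by
      have ha' := (Complex.continuous_ofReal.tendsto a).comp ha
      have hb' := (Complex.continuous_ofReal.tendsto b).comp hb
      exact (((ha'.add (hb'.const_mul Complex.I)).const_mul μ).cexp).const_mul _
    refine ⟨((g (1/2 : ℝ) * Complex.exp (μ * ((a : ℂ) + Complex.I * (b : ℂ))) : ℂ) : OnePoint ℂ), ?_⟩
    exact (OnePoint.continuous_coe.tendsto _).comp (h1.congr' hev)
  · refine ⟨OnePoint.infty, ?_⟩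
    have hn : Tendsto (fun r : ℝ => ‖g (1/2 : ℝ) * Complex.exp (Φ r)‖) (𝓝[<] 1) atTop := by
      have h1 : ∀ r, ‖g (1/2 : ℝ) * Complex.exp (Φ r)‖ =
          ‖g (1/2 : ℝ)‖ * Real.exp (Real.cos lam * G r + -(Real.sin lam * H r)) := by
        intro r
        rw [norm_mul, Complex.norm_exp]
        congr 2
        simp only [Φ, hμ]
        rw [Complex.mul_re, Complex.exp_ofReal_mul_I_re, Complex.exp_ofReal_mul_I_im]
        simp
        ring
      simp only [h1]
      refine Tendsto.const_mul_atTop (norm_pos_iff.2 hhalf) (Real.tendsto_exp_atTop.comp ?_)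
      exact (hinf.const_mul_atTop hc).atTop_add ((hb.const_mul (Real.sin lam)).neg)
    have h2 : Tendsto (fun r : ℝ => g r) (𝓝[<] 1) (coclosedCompact ℂ) := by
      rw [coclosedCompact_eq_cocompact, ← Metric.cobounded_eq_cocompact]
      exact (tendsto_norm_atTop_iff_cobounded.1 hn).congr' hev
    exact OnePoint.tendsto_coe_infty.comp h2

end Helpers

/-- for `f ∈ F_λ`, the radial limit `lim_{r→1−} f(r e^{it})` exists in the
Riemann sphere (the one-point compactification of `ℂ`) for every `t`. -/
theorem radial_limit_exists_onePoint (lam : ℝ)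
    (hlam : lam ∈ Set.Ioo (-(Real.pi / 2)) (Real.pi / 2))
    (f : ℂ → ℂ) (hf : f ∈ SpiralClass lam) :
    ∀ t : ℝ, ∃ w : OnePoint ℂ, Tendsto
      (fun r : ℝ => (f ((r : ℂ) * Complex.exp ((t : ℂ) * Complex.I)) : OnePoint ℂ))
      (𝓝[<] 1) (𝓝 w) := by
  intro t
  obtain ⟨hd, h0, h1, hne, hre⟩ := hf
  set u : ℂ := Complex.exp ((t : ℂ) * Complex.I) with hu
  have hun : ‖u‖ = 1 := Complex.norm_exp_ofReal_mul_I t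
  have hu0 : u ≠ 0 := Complex.exp_ne_zero _
  have hc : 0 < Real.cos lam := Real.cos_pos_of_mem_Ioo ⟨hlam.1, hlam.2⟩
  let g : ℂ → ℂ := fun z => f (z * u)
  have hmap : ∀ z ∈ ball (0:ℂ) 1, z * u ∈ ball (0:ℂ) 1 := by
    intro z hz
    simpa [hun] using hz
  have hg : DifferentiableOn ℂ g (ball 0 1) :=
    hd.comp (by fun_prop) hmap
  have hgd : ∀ z ∈ ball (0:ℂ) 1, deriv g z = deriv f (z * u) * u := by
    intro z hz
    have h2 := (hd.differentiableAt (isOpen_ball.mem_nhds (hmap z hz))).hasDerivAt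
    have h3 : HasDerivAt (fun z : ℂ => z * u) u z := by
      simpa using (hasDerivAt_id' z).mul_const u
    exact (h2.comp z h3).deriv
  have hg0 : g 0 = 0 := by simp [g, h0]
  have hz0 : (0:ℂ) ∈ ball (0:ℂ) 1 := by simp
  have hg1 : deriv g 0 = u := by rw [hgd 0 hz0]; simp [h1]
  have hgne : ∀ z ∈ ball (0:ℂ) 1, z ≠ 0 → g z ≠ 0 := fun z hz hz' =>
    hne _ (hmap z hz) (mul_ne_zero hz' hu0)
  have hds : ∀ z : ℂ, z ≠ 0 → dslope g 0 z = g z / z := by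
    intro z hz
    rw [dslope_of_ne _ hz, slope_def_field, hg0]; simp
  have hdsne : ∀ z ∈ ball (0:ℂ) 1, dslope g 0 z ≠ 0 := by
    intro z hz
    by_cases h : z = 0
    · rw [h, dslope_same, hg1]; exact hu0
    · rw [hds z h]; exact div_ne_zero (hgne z hz h) h
  let p : ℂ → ℂ := fun z => Complex.exp (-(lam : ℂ) * Complex.I) * (deriv g z / dslope g 0 z)
  have hp : DifferentiableOn ℂ p (ball 0 1) := by
    refine DifferentiableOn.const_mul ((hg.deriv isOpen_ball).div ?_ hdsne) _
    exact (Complex.differentiableOn_dslope (isOpen_ball.mem_nhds hz0)).2 hg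
  refine limit_of_ode lam hc g p hg hgne hp ?_ ?_
  · intro z hz
    by_cases h : z = 0
    · subst h
      simp only [p, dslope_same, hg1, div_self hu0, mul_one]
      rw [show (-(lam:ℂ)) * Complex.I = ((-lam : ℝ) : ℂ) * Complex.I by push_cast; ring,
        Complex.exp_ofReal_mul_I_re, Real.cos_neg]
      exact hc.le
    · have h2 := hre _ (hmap z hz) (mul_ne_zero h hu0)
      have h3 := hgne z hz h
      simp only [p]
      rw [hds z h, hgd z hz]
      have h5 : Complex.exp (-(lam : ℂ) * Complex.I) * (deriv f (z * u) * u / (g z / z))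
          = Complex.exp (-(lam : ℂ) * Complex.I) * (z * u) * deriv f (z * u) / f (z * u) := by
        simp only [g] at h3 ⊢
        field_simp
      rw [h5]
      exact h2.le
  · intro z hz h
    have h3 := hgne z hz h
    simp only [p]
    rw [hds z h]
    have h4 : Complex.exp (lam * Complex.I) * Complex.exp (-(lam : ℂ) * Complex.I) = 1 := by
      rw [← Complex.exp_add]; simp
    calc deriv g z = (Complex.exp (lam * Complex.I) * Complex.exp (-(lam : ℂ) * Complex.I))
          * deriv g z := by rw [h4, one_mul]
      _ = _ := by field_simp
end

section
/- Let λ ∈ (−π/2, π/2) and f ∈ F_λ, and define β_λ(t, f) = lim_{r→1−} u_f(r e^{it}) + t (which exists for every t and is non-decreasing in t). Then for every t₀ ∈ ℝ the one-sided limits β_λ(t₀+, f) and β_λ(t₀−, f) satisfy β_λ(t₀, f) = (β_λ(t₀+, f) + β_λ(t₀−, f))/2. -/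
open Set Metric Filter Topology Function

/-- The normalized Poisson kernel in real coordinates. -/
noncomputable def pk (r s : ℝ) : ℝ := (2 * Real.pi)⁻¹ * ((1 - r ^ 2) / (1 - 2 * r * Real.cos s + r ^ 2))

lemma pk_den_pos {r : ℝ} (hr0 : 0 ≤ r) (hr : r < 1) (s : ℝ) : 0 < 1 - 2 * r * Real.cos s + r ^ 2 := by
  nlinarith [Real.cos_le_one s, mul_nonneg hr0 (sub_nonneg.2 (Real.cos_le_one s)), mul_pos (sub_pos.2 hr) (sub_pos.2 hr)]

lemma pk_nonneg {r : ℝ} (hr0 : 0 ≤ r) (hr : r < 1) (s : ℝ) : 0 ≤ pk r s := by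
  have h := pk_den_pos hr0 hr s
  have : 0 ≤ 1 - r ^ 2 := by nlinarith
  unfold pk; positivity

lemma pk_continuous {r : ℝ} (hr0 : 0 ≤ r) (hr : r < 1) : Continuous (pk r) := by
  unfold pk
  have := fun s => (pk_den_pos hr0 hr s).ne'
  fun_prop (disch := assumption)

lemma pk_neg (r s : ℝ) : pk r (-s) = pk r s := by simp [pk]

lemma pk_eq (r s : ℝ) : poissonKernel 0 (r : ℂ) (circleMap 0 1 s) = (1 - r ^ 2) / (1 - 2 * r * Real.cos s + r ^ 2) := by
  rw [poissonKernel_def]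
  have : ‖circleMap 0 1 s - r‖ ^ 2 = 1 - 2 * r * Real.cos s + r ^ 2 := by
    rw [← Complex.normSq_eq_norm_sq, Complex.normSq_apply]
    simp [circleMap, Complex.exp_re, Complex.exp_im]
    nlinarith [Real.sin_sq_add_cos_sq s]
  simp [this]

lemma poisson_complex {g : ℂ → ℂ} (hg : DiffContOnCl ℂ g (ball 0 1)) {r : ℝ} (hr0 : 0 ≤ r) (hr : r < 1) :
    ∫ s in (-Real.pi)..Real.pi, (pk r s : ℂ) * g (Complex.exp (s * Complex.I)) = g r := by
  have h := hg.circleAverage_poissonKernel_smul (w := (r : ℂ)) (by simpa [abs_of_nonneg hr0] using hr)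
  rw [Real.circleAverage_eq_integral_add (-Real.pi)] at h
  rw [intervalIntegral.integral_comp_add_right (fun s => (poissonKernel 0 (r : ℂ) • g) (circleMap 0 1 s))] at h
  rw [← h, ← intervalIntegral.integral_smul]
  have e1 : 0 + -Real.pi = -Real.pi := by ring
  have e2 : 2 * Real.pi + -Real.pi = Real.pi := by ring
  rw [e1, e2]
  refine intervalIntegral.integral_congr fun s _ => ?_
  simp only [Pi.smul_apply', pk_eq]
  simp [pk, circleMap]
  ring

lemma pk_integral {r : ℝ} (hr0 : 0 ≤ r) (hr : r < 1) : ∫ s in (-Real.pi)..Real.pi, pk r s = 1 := by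
  have := poisson_complex (g := fun _ => 1) (diffContOnCl_const) hr0 hr
  simp only [mul_one] at this
  rw [intervalIntegral.integral_ofReal] at this
  exact_mod_cast this

lemma poisson_im {G : ℂ → ℂ} (hG : DifferentiableOn ℂ G (ball 0 1)) {r ρ : ℝ} (hr0 : 0 ≤ r) (hr : r < 1)
    (hρ0 : 0 ≤ ρ) (hρ : ρ < 1) (θ : ℝ) :
    ∫ s in (-Real.pi)..Real.pi, pk r s * (G (ρ * Complex.exp ((θ + s : ℝ) * Complex.I))).im =
      (G (ρ * r * Complex.exp (θ * Complex.I))).im := by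
  have hmaps : MapsTo (fun z : ℂ => ρ * Complex.exp (θ * Complex.I) * z) (closedBall 0 1) (ball 0 1) := by
    intro z hz
    simp only [mem_closedBall_zero_iff, mem_ball_zero_iff] at *
    simp only [norm_mul, Complex.norm_real, Complex.norm_exp_ofReal_mul_I, Real.norm_eq_abs, abs_of_nonneg hρ0]
    nlinarith
  have hd : DiffContOnCl ℂ (fun z => G (ρ * Complex.exp (θ * Complex.I) * z)) (ball 0 1) := by
    apply DifferentiableOn.diffContOnCl
    rw [closure_ball 0 one_ne_zero]
    exact hG.comp (by fun_prop) hmaps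
  have h := poisson_complex hd hr0 hr
  have hc : Continuous fun s : ℝ => G (ρ * Complex.exp (θ * Complex.I) * Complex.exp (s * Complex.I)) := by
    refine (hG.continuousOn).comp_continuous (by fun_prop) fun s => hmaps ?_
    simp [Complex.norm_exp_ofReal_mul_I]
  have hi : IntervalIntegrable (fun s : ℝ => (pk r s : ℂ) * G (ρ * Complex.exp (θ * Complex.I) * Complex.exp (s * Complex.I)))
      MeasureTheory.volume (-Real.pi) Real.pi := by
    have := pk_continuous hr0 hr
    exact ((Complex.continuous_ofReal.comp this).mul hc).intervalIntegrable _ _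
  have h2 := Complex.imCLM.intervalIntegral_comp_comm hi
  rw [h] at h2
  simp only [Complex.imCLM_apply, Complex.im_ofReal_mul] at h2
  rw [show (ρ : ℂ) * r * Complex.exp (θ * Complex.I) = ρ * Complex.exp (θ * Complex.I) * r by ring, ← h2]
  refine intervalIntegral.integral_congr fun s _ => ?_
  congr 3
  push_cast
  rw [add_mul, Complex.exp_add]; ring

lemma pk_unif (u : Set ℝ) (hu : IsOpen u) (h0 : (0 : ℝ) ∈ u) :
    TendstoUniformlyOn pk 0 (𝓝[<] 1) (Icc (-Real.pi) Real.pi \ u) := by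
  obtain ⟨δ, hδ, hsub⟩ := Metric.isOpen_iff.1 hu 0 h0
  set d := min δ Real.pi with hd
  have hd0 : 0 < d := lt_min hδ Real.pi_pos
  have hdpi : d ≤ Real.pi := min_le_right _ _
  have hc : Real.cos d < 1 := by
    have := Real.cos_lt_cos_of_nonneg_of_le_pi le_rfl hdpi hd0
    simpa using this
  have hlim : Tendsto (fun r : ℝ => (2 * Real.pi)⁻¹ * ((1 - r ^ 2) / (1 - Real.cos d))) (𝓝[<] 1) (𝓝 0) := by
    have : ContinuousAt (fun r : ℝ => (2 * Real.pi)⁻¹ * ((1 - r ^ 2) / (1 - Real.cos d))) 1 := by fun_prop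
    have h := this.tendsto
    simp only [one_pow, sub_self, zero_div, mul_zero] at h
    exact h.mono_left nhdsWithin_le_nhds
  rw [Metric.tendstoUniformlyOn_iff]
  intro ε hε
  have hI : Ioo (1/2 : ℝ) 1 ∈ 𝓝[<] (1:ℝ) := Ioo_mem_nhdsLT (by norm_num)
  filter_upwards [hI, hlim.eventually (gt_mem_nhds hε)] with r hr hr2 s hs
  have hr0 : 0 ≤ r := by linarith [hr.1]
  simp only [Pi.zero_apply, dist_zero_left, Real.norm_eq_abs, abs_of_nonneg (pk_nonneg hr0 hr.2 s)]
  refine lt_of_le_of_lt ?_ hr2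
  have hs1 : d ≤ |s| := by
    by_contra hcon
    push Not at hcon
    exact hs.2 (hsub (by simpa using hcon.trans_le (min_le_left _ _)))
  have hs2 : |s| ≤ Real.pi := abs_le.2 hs.1
  have hcos : Real.cos s ≤ Real.cos d := by
    rw [← Real.cos_abs s]
    exact Real.cos_le_cos_of_nonneg_of_le_pi hd0.le hs2 hs1
  unfold pk
  have := hr.1
  have := hr.2
  have h3 : 0 ≤ 1 - r ^ 2 := by nlinarith
  have h4 : 1 - Real.cos d ≤ 1 - 2 * r * Real.cos s + r ^ 2 := by
    nlinarith [mul_nonneg (show 0 ≤ 2 * r - 1 by linarith) (sub_nonneg.2 (hcos.trans hc.le)), sq_nonneg (1 - r)]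
  have h5 : 0 < 1 - Real.cos d := by linarith
  have := Real.pi_pos
  gcongr

lemma spiral_mono (lam : ℝ)
    (hlam : lam ∈ Set.Ioo (-(Real.pi / 2)) (Real.pi / 2))
    (f : ℂ → ℂ) (hf : f ∈ SpiralClass lam) (L : ℂ → ℂ) (hL : IsLogBranch f L) {ρ : ℝ} (hρ0 : 0 < ρ) (hρ : ρ < 1) :
    Monotone fun t : ℝ => lambdaArgBranch lam L ((ρ : ℂ) * Complex.exp ((t : ℂ) * Complex.I)) + t := by
  obtain ⟨hfd, -, -, hfne, hfpos⟩ := hf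
  obtain ⟨hLd, -, hLexp⟩ := hL
  have hcos : 0 < Real.cos lam := Real.cos_pos_of_mem_Ioo hlam
  have key : ∀ t : ℝ, ∃ D : ℝ, 0 ≤ D ∧ HasDerivAt (fun t : ℝ => lambdaArgBranch lam L ((ρ : ℂ) * Complex.exp ((t : ℂ) * Complex.I)) + t) D t := by
    intro t
    set z : ℂ := (ρ : ℂ) * Complex.exp ((t : ℂ) * Complex.I) with hz
    have hzn : ‖z‖ = ρ := by simp [hz, Complex.norm_exp_ofReal_mul_I, abs_of_pos hρ0]
    have hzb : z ∈ ball (0:ℂ) 1 := by simpa [hzn] using hρ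
    have hz0 : z ≠ 0 := by rw [← norm_pos_iff, hzn]; exact hρ0
    have hfz := hfne z hzb hz0
    have hLz : HasDerivAt L (deriv L z) z := (hLd.differentiableAt (isOpen_ball.mem_nhds hzb)).hasDerivAt
    have hfz' : HasDerivAt f (deriv f z) z := (hfd.differentiableAt (isOpen_ball.mem_nhds hzb)).hasDerivAt
    have hLder : z * deriv L z = z * deriv f z / f z - 1 := by
      have h1 := hLz.cexp
      have h2 := hfz'.div (hasDerivAt_id z) hz0
      have he : (fun x => Complex.exp (L x)) =ᶠ[𝓝 z] (f / id) := by
        filter_upwards [isOpen_ball.mem_nhds hzb, isOpen_ne.mem_nhds hz0] with x hx hx0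
        simpa using hLexp x hx hx0
      have h3 := h1.unique (h2.congr_of_eventuallyEq he)
      rw [hLexp z hzb hz0] at h3
      simp only [id] at h3
      field_simp at h3
      field_simp
      linear_combination h3
    have hin : HasDerivAt (fun t : ℝ => (ρ : ℂ) * Complex.exp ((t : ℂ) * Complex.I)) (z * Complex.I) t := by
      have h1 : HasDerivAt (fun t : ℝ => ((t : ℂ) * Complex.I)) (1 * Complex.I) t :=
        (Complex.ofRealCLM.hasDerivAt).mul_const _
      have := (h1.cexp).const_mul (ρ : ℂ)
      simpa [hz, mul_assoc] using this
    have hLt : HasDerivAt (fun t : ℝ => L ((ρ : ℂ) * Complex.exp ((t : ℂ) * Complex.I))) (deriv L z * (z * Complex.I)) t :=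
      HasDerivAt.comp (h₂ := L) t hLz hin
    have him := Complex.imCLM.hasFDerivAt.comp_hasDerivAt t hLt
    have hre := Complex.reCLM.hasFDerivAt.comp_hasDerivAt t hLt
    refine ⟨_, ?_, (him.sub (hre.const_mul (Real.tan lam))).add (hasDerivAt_id t)⟩
    have hp := hfpos z hzb hz0
    set q := z * deriv f z / f z with hq
    have e1 : deriv L z * (z * Complex.I) = (q - 1) * Complex.I := by rw [← hLder]; ring
    rw [e1]
    rw [mul_assoc, mul_div_assoc, ← hq, show -(lam : ℂ) * Complex.I = ((-lam : ℝ) : ℂ) * Complex.I by push_cast; ring, Complex.mul_re, Complex.exp_ofReal_mul_I_re, Complex.exp_ofReal_mul_I_im] at hp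
    simp at hp ⊢
    rw [Real.tan_eq_sin_div_cos]
    have : 0 ≤ (Real.cos lam * q.re + Real.sin lam * q.im) / Real.cos lam := by
      apply div_nonneg _ hcos.le
      linarith
    have e2 : (Real.cos lam * q.re + Real.sin lam * q.im) / Real.cos lam = q.re + Real.sin lam / Real.cos lam * q.im := by
      field_simp
    linarith
  choose D hD0 hD using key
  refine monotone_of_deriv_nonneg (fun t => (hD t).differentiableAt) fun t => ?_
  rw [(hD t).deriv]; exact hD0 t

/-- Poisson representation of `u` through its radial boundary values. -/
lemma poisson_boundary (lam : ℝ)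
    (hlam : lam ∈ Set.Ioo (-(Real.pi / 2)) (Real.pi / 2))
    (f : ℂ → ℂ) (hf : f ∈ SpiralClass lam) (L : ℂ → ℂ) (hL : IsLogBranch f L)
    (β : ℝ → ℝ)
    (hβ : ∀ t : ℝ, Tendsto
        (fun r : ℝ => lambdaArgBranch lam L ((r : ℂ) * Complex.exp ((t : ℂ) * Complex.I)) + t)
        (𝓝[<] 1) (𝓝 (β t))) (θ : ℝ) {r : ℝ} (hr0 : 0 ≤ r) (hr : r < 1) :
    lambdaArgBranch lam L ((r : ℂ) * Complex.exp ((θ : ℂ) * Complex.I)) =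
      ∫ s in (-Real.pi)..Real.pi, pk r s * (β (θ + s) - (θ + s)) := by
  set G : ℂ → ℂ := fun z => (1 - Real.tan lam * Complex.I) * L z with hGdef
  have hG : DifferentiableOn ℂ G (ball 0 1) := hL.1.const_mul _
  have hGu : ∀ z, (G z).im = lambdaArgBranch lam L z := by
    intro z
    simp only [hGdef, lambdaArgBranch, Complex.mul_im, Complex.sub_re, Complex.sub_im, Complex.one_re, Complex.one_im,
      Complex.ofReal_re, Complex.ofReal_im, Complex.I_re, Complex.I_im, Complex.mul_re]
    ring
  have hI : Ioo (0 : ℝ) 1 ∈ 𝓝[<] (1:ℝ) := Ioo_mem_nhdsLT (by norm_num)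
  have hball : ∀ t : ℝ, ∀ a : ℝ, 0 ≤ a → a < 1 → (a : ℂ) * Complex.exp (t * Complex.I) ∈ ball (0:ℂ) 1 := by
    intro t a h1 h2
    simpa [Complex.norm_exp_ofReal_mul_I, abs_of_nonneg h1] using h2
  -- left side
  have hleft : Tendsto (fun ρ : ℝ => (G (ρ * r * Complex.exp (θ * Complex.I))).im) (𝓝[<] 1)
      (𝓝 (lambdaArgBranch lam L ((r : ℂ) * Complex.exp ((θ : ℂ) * Complex.I)))) := by
    have h1 : ContinuousAt G ((1:ℝ) * r * Complex.exp (θ * Complex.I)) := by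
      apply (hG.differentiableAt (isOpen_ball.mem_nhds _)).continuousAt
      simpa using hball θ r hr0 hr
    have h2 : ContinuousAt (fun ρ : ℝ => (G (ρ * r * Complex.exp (θ * Complex.I))).im) 1 :=
      Complex.continuous_im.continuousAt.comp
        (ContinuousAt.comp (f := fun ρ : ℝ => (ρ : ℂ) * r * Complex.exp (θ * Complex.I)) h1 (by fun_prop))
    have h3 := h2.tendsto
    simp only [hGu, Complex.ofReal_one, one_mul] at h3 ⊢
    exact h3.mono_left nhdsWithin_le_nhds
  -- right side
  have hright : Tendsto (fun ρ : ℝ => ∫ s in (-Real.pi)..Real.pi, pk r s * (G (ρ * Complex.exp ((θ + s : ℝ) * Complex.I))).im) (𝓝[<] 1)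
      (𝓝 (∫ s in (-Real.pi)..Real.pi, pk r s * (β (θ + s) - (θ + s)))) := by
    set C : ℝ := |β (θ + Real.pi)| + |β (θ - Real.pi)| + 1 + |θ| + Real.pi with hC
    have b1 : ∀ᶠ ρ : ℝ in 𝓝[<] (1:ℝ), lambdaArgBranch lam L ((ρ : ℂ) * Complex.exp (((θ + Real.pi : ℝ) : ℂ) * Complex.I)) + (θ + Real.pi) < |β (θ + Real.pi)| + 1 :=
      (hβ (θ + Real.pi)).eventually (gt_mem_nhds (by linarith [le_abs_self (β (θ + Real.pi))]))
    have b2 : ∀ᶠ ρ : ℝ in 𝓝[<] (1:ℝ), -|β (θ - Real.pi)| - 1 < lambdaArgBranch lam L ((ρ : ℂ) * Complex.exp (((θ - Real.pi : ℝ) : ℂ) * Complex.I)) + (θ - Real.pi) :=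
      (hβ (θ - Real.pi)).eventually (lt_mem_nhds (by linarith [neg_abs_le (β (θ - Real.pi))]))
    refine intervalIntegral.tendsto_integral_filter_of_dominated_convergence (fun s => pk r s * C) ?_ ?_ ?_ ?_
    · filter_upwards [hI] with ρ hρ
      refine Continuous.aestronglyMeasurable ((pk_continuous hr0 hr).mul (Complex.continuous_im.comp ?_))
      exact hG.continuousOn.comp_continuous (by fun_prop) fun s => hball _ ρ hρ.1.le hρ.2
    · filter_upwards [hI, b1, b2] with ρ hρ h1 h2
      refine Eventually.of_forall fun s hs => ?_
      rw [uIoc_of_le (by linarith [Real.pi_pos])] at hs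
      have hm := spiral_mono lam hlam f hf L hL hρ.1 hρ.2
      have m1 := hm (show θ + s ≤ θ + Real.pi by linarith [hs.2])
      have m2 := hm (show θ - Real.pi ≤ θ + s by linarith [hs.1])
      simp only at m1 m2
      rw [norm_mul, Real.norm_eq_abs, abs_of_nonneg (pk_nonneg hr0 hr s), hGu, Real.norm_eq_abs]
      refine mul_le_mul_of_nonneg_left (abs_le.2 ?_) (pk_nonneg hr0 hr s)
      have := neg_abs_le θ
      have := le_abs_self θ
      have := abs_nonneg (β (θ + Real.pi))
      have := abs_nonneg (β (θ - Real.pi))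
      have := hs.1
      have := hs.2
      constructor <;> linarith
    · exact ((pk_continuous hr0 hr).mul continuous_const).intervalIntegrable _ _
    · refine Eventually.of_forall fun s _ => ?_
      refine Tendsto.const_mul _ ?_
      simp only [hGu]
      have := (hβ (θ + s)).sub_const (θ + s)
      simpa using this
  refine tendsto_nhds_unique hleft (hright.congr' ?_)
  filter_upwards [hI] with ρ hρ
  exact poisson_im hG hr0 hr hρ.1.le hρ.2 θ

/-- for `f ∈ F_λ`, the boundary angle function
`β_λ(t,f) = lim_{r→1−} u_f(r e^{it}) + t` satisfies
`β_λ(t₀,f) = (β_λ(t₀+,f) + β_λ(t₀−,f))/2` at every `t₀`. -/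
theorem beta_midpoint_of_one_sided_limits (lam : ℝ)
    (hlam : lam ∈ Set.Ioo (-(Real.pi / 2)) (Real.pi / 2))
    (f : ℂ → ℂ) (hf : f ∈ SpiralClass lam) (L : ℂ → ℂ) (hL : IsLogBranch f L)
    (β : ℝ → ℝ) (hmono : Monotone β)
    (hβ : ∀ t : ℝ, Tendsto
        (fun r : ℝ => lambdaArgBranch lam L ((r : ℂ) * Complex.exp ((t : ℂ) * Complex.I)) + t)
        (𝓝[<] 1) (𝓝 (β t))) :
    ∀ t₀ : ℝ, β t₀ = (Function.rightLim β t₀ + Function.leftLim β t₀) / 2 := by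
  intro θ
  set m := (Function.rightLim β θ + Function.leftLim β θ) / 2 with hm
  have hpi := Real.pi_pos
  set h : ℝ → ℝ := fun s => (β (θ + s) + β (θ - s)) / 2 with hh
  have hiβ : ∀ a b, IntervalIntegrable (fun s => β (θ + s)) MeasureTheory.volume a b := fun a b =>
    Monotone.intervalIntegrable (fun x y hxy => hmono (by linarith))
  have hiβ' : ∀ a b, IntervalIntegrable (fun s => β (θ - s)) MeasureTheory.volume a b := fun a b =>
    Antitone.intervalIntegrable (fun x y hxy => hmono (by linarith))
  -- symmetrized Poisson formula
  have hrep : ∀ r : ℝ, 0 ≤ r → r < 1 →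
      lambdaArgBranch lam L ((r : ℂ) * Complex.exp ((θ : ℂ) * Complex.I)) + θ =
        ∫ s in (-Real.pi)..Real.pi, pk r s * h s := by
    intro r hr0 hr
    have hc := pk_continuous hr0 hr
    have e1 := poisson_boundary lam hlam f hf L hL β hβ θ hr0 hr
    have e2 : ∫ s in (-Real.pi)..Real.pi, pk r s * (β (θ - s) - (θ - s)) =
        ∫ s in (-Real.pi)..Real.pi, pk r s * (β (θ + s) - (θ + s)) := by
      have := intervalIntegral.integral_comp_neg (a := -Real.pi) (b := Real.pi)
        (fun s => pk r s * (β (θ + s) - (θ + s)))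
      simp only [neg_neg, pk_neg, ← sub_eq_add_neg] at this
      exact this
    have i1 : IntervalIntegrable (fun s => pk r s * (β (θ + s) - (θ + s))) MeasureTheory.volume (-Real.pi) Real.pi :=
      IntervalIntegrable.continuousOn_mul ((hiβ _ _).sub (Continuous.intervalIntegrable (by fun_prop) _ _)) hc.continuousOn
    have i2 : IntervalIntegrable (fun s => pk r s * (β (θ - s) - (θ - s))) MeasureTheory.volume (-Real.pi) Real.pi :=
      IntervalIntegrable.continuousOn_mul ((hiβ' _ _).sub (Continuous.intervalIntegrable (by fun_prop) _ _)) hc.continuousOn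
    have i3 : IntervalIntegrable (fun s => pk r s * (2 * θ)) MeasureTheory.volume (-Real.pi) Real.pi :=
      (hc.mul continuous_const).intervalIntegrable _ _
    have e3 : ∫ s in (-Real.pi)..Real.pi, pk r s * (2 * θ) = 2 * θ := by
      rw [intervalIntegral.integral_mul_const, pk_integral hr0 hr, one_mul]
    have e4 : ∫ s in (-Real.pi)..Real.pi, pk r s * h s =
        ∫ s in (-Real.pi)..Real.pi, (1/2 : ℝ) * ((pk r s * (β (θ + s) - (θ + s)) + pk r s * (β (θ - s) - (θ - s))) + pk r s * (2 * θ)) := by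
      refine intervalIntegral.integral_congr fun s _ => ?_
      simp only [hh]
      ring
    rw [e4, intervalIntegral.integral_const_mul, intervalIntegral.integral_add (i1.add i2) i3,
      intervalIntegral.integral_add i1 i2, e2, e3, ← e1]
    ring
  -- limit of `h` at `0`
  have hlim : Tendsto h (𝓝[≠] 0) (𝓝 m) := by
    have r1 : Tendsto (fun s : ℝ => θ + s) (𝓝[>] 0) (𝓝[>] θ) := by
      refine tendsto_nhdsWithin_iff.2 ⟨?_, ?_⟩
      · have : Continuous fun s : ℝ => θ + s := by fun_prop
        simpa using (this.tendsto 0).mono_left nhdsWithin_le_nhds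
      · filter_upwards [self_mem_nhdsWithin] with s hs
        simpa using hs
    have r2 : Tendsto (fun s : ℝ => θ - s) (𝓝[>] 0) (𝓝[<] θ) := by
      refine tendsto_nhdsWithin_iff.2 ⟨?_, ?_⟩
      · have : Continuous fun s : ℝ => θ - s := by fun_prop
        simpa using (this.tendsto 0).mono_left nhdsWithin_le_nhds
      · filter_upwards [self_mem_nhdsWithin] with s hs
        simpa using hs
    have hp : Tendsto h (𝓝[>] 0) (𝓝 m) :=
      (((hmono.tendsto_rightLim θ).comp r1).add ((hmono.tendsto_leftLim θ).comp r2)).div_const 2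
    have hn : Tendsto h (𝓝[<] 0) (𝓝 m) := by
      have r3 : Tendsto (fun s : ℝ => -s) (𝓝[<] 0) (𝓝[>] 0) := by
        simpa using tendsto_neg_nhdsLT (a := (0:ℝ))
      have := hp.comp r3
      refine this.congr fun s => ?_
      simp only [hh, Function.comp]
      rw [sub_neg_eq_add, ← sub_eq_add_neg, add_comm]
    rw [← Iio_union_Ioi, nhdsWithin_union]
    exact hn.sup hp
  -- peak argument
  set S : Set ℝ := Ioc (-Real.pi) Real.pi \ {0} with hS
  have hSm : MeasurableSet S := measurableSet_Ioc.diff (measurableSet_singleton 0)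
  have hae : S =ᵐ[MeasureTheory.volume] Ioc (-Real.pi) Real.pi :=
    MeasureTheory.diff_null_ae_eq_self (by simp)
  have hconv : ∀ g : ℝ → ℝ, ∫ s in S, g s = ∫ s in (-Real.pi)..Real.pi, g s := by
    intro g
    rw [intervalIntegral.integral_of_le (by linarith), MeasureTheory.setIntegral_congr_set hae]
  have hI : Ioo (0 : ℝ) 1 ∈ 𝓝[<] (1:ℝ) := Ioo_mem_nhdsLT (by norm_num)
  have hpeak : Tendsto (fun r : ℝ => ∫ s in S, pk r s • h s) (𝓝[<] 1) (𝓝 m) := by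
    refine tendsto_setIntegral_peak_smul_of_integrableOn_of_tendsto (x₀ := 0) (t := S) hSm hSm subset_rfl
      self_mem_nhdsWithin ?_ ?_ ?_ ?_ ?_ ?_ ?_
    · rw [MeasureTheory.measure_congr hae]; simp
    · filter_upwards [hI] with r hr s _ using pk_nonneg hr.1.le hr.2 s
    · intro u hu h0
      exact (pk_unif u hu h0).mono (diff_subset_diff_left (diff_subset.trans Ioc_subset_Icc_self))
    · refine tendsto_const_nhds.congr' ?_
      filter_upwards [hI] with r hr
      rw [hconv, pk_integral hr.1.le hr.2]
    · filter_upwards [hI] with r hr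
      exact (pk_continuous hr.1.le hr.2).aestronglyMeasurable
    · have : IntervalIntegrable h MeasureTheory.volume (-Real.pi) Real.pi := ((hiβ _ _).add (hiβ' _ _)).div_const 2
      rw [intervalIntegrable_iff_integrableOn_Ioc_of_le (by linarith)] at this
      exact this.mono_set diff_subset
    · exact hlim.mono_left (nhdsWithin_mono _ fun s hs => hs.2)
  refine tendsto_nhds_unique (hβ θ) (hpeak.congr' ?_)
  filter_upwards [hI] with r hr
  rw [hconv, hrep r hr.1.le hr.2]
  simp
end
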